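/- For every constant c > 0 there exists a constant C > 0 such that the following holds. Let x_1,…,x_n ∈ ℝ^d satisfy ‖x_i‖₂² ≤ r for all i, let K ∈ ℝ^{n×n} be the Gaussian kernel matrix K_{ij} = exp(−‖x_i − x_j‖₂²/2), let q be an integer with q ≥ C(r + log n), and let A be the matrix with n columns whose i-th column is φ_q(x_i), where φ_q is the degree-q polynomial lifting for the Gaussian kernel. Then ‖A^⊤A − K‖_op ≤ n^{-c}, where ‖·‖_op is the operator (spectral) norm. -/

import Mathlib

open Matrix

lemma exp_tail_bound (y s : ℝ) (hy : |y| ≤ s) (q : ℕ) :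
    |∑ k ∈ Finset.range (q + 1), y ^ k / (k.factorial : ℝ) - Real.exp y|
      ≤ Real.exp (-(q : ℝ)) * Real.exp (Real.exp 1 * s) := by
  have hs : 0 ≤ s := (abs_nonneg y).trans hy
  have hE : 0 ≤ Real.exp 1 * s := by positivity
  have hsum : ∀ z : ℝ, HasSum (fun k : ℕ => z ^ k / (k.factorial : ℝ)) (Real.exp z) := by
    intro z
    rw [Real.exp_eq_exp_ℝ]
    exact NormedSpace.expSeries_div_hasSum_exp z
  have h1 := (hsum y).summable.sum_add_tsum_nat_add (q + 1)
  have h2 := (hsum (Real.exp 1 * s)).summable.sum_add_tsum_nat_add (q + 1)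
  rw [(hsum _).tsum_eq] at h1 h2
  have h3 : 0 ≤ ∑ k ∈ Finset.range (q + 1), (Real.exp 1 * s) ^ k / (k.factorial : ℝ) :=
    Finset.sum_nonneg fun k _ => by positivity
  have hsm := (summable_nat_add_iff (q + 1)).2 (hsum (Real.exp 1 * s)).summable
  have h4 := tsum_of_norm_bounded (hsm.hasSum.mul_left (Real.exp (-(q : ℝ))))
    (f := fun k : ℕ => y ^ (k + (q + 1)) / ((k + (q + 1)).factorial : ℝ)) (by
      intro k
      rw [Real.norm_eq_abs, abs_div, abs_pow, Nat.abs_cast, ← mul_div_assoc]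
      gcongr
      rw [mul_pow, ← mul_assoc, ← Real.exp_nat_mul, ← Real.exp_add]
      have : 1 ≤ Real.exp (-(q : ℝ) + ((k + (q + 1) : ℕ) : ℝ) * 1) := by
        apply Real.one_le_exp
        push_cast
        have : (0 : ℝ) ≤ k := Nat.cast_nonneg k
        linarith
      calc |y| ^ (k + (q + 1)) ≤ s ^ (k + (q + 1)) := by gcongr
        _ ≤ _ := le_mul_of_one_le_left (by positivity) this)
  rw [Real.norm_eq_abs] at h4
  have h5 : ∑ k ∈ Finset.range (q + 1), y ^ k / (k.factorial : ℝ) - Real.exp y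
      = - ∑' k : ℕ, y ^ (k + (q + 1)) / ((k + (q + 1)).factorial : ℝ) := by
    linarith
  rw [h5, abs_neg]
  refine h4.trans ?_
  gcongr
  linarith

lemma opNorm_le_of_entries (n : ℕ) (M : Matrix (Fin n) (Fin n) ℝ) (m : ℝ) (hm : 0 ≤ m)
    (h : ∀ i j, |M i j| ≤ m) :
    ‖Matrix.toEuclideanCLM (𝕜 := ℝ) M‖ ≤ n * m := by
  apply ContinuousLinearMap.opNorm_le_bound _ (by positivity)
  intro v
  apply abs_le_of_sq_le_sq' _ (by positivity) |>.2
  rw [mul_pow, EuclideanSpace.real_norm_sq_eq, EuclideanSpace.real_norm_sq_eq]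
  have key : ∀ i, ((Matrix.toEuclideanCLM (𝕜 := ℝ) M) v i) ^ 2 ≤ (n * m ^ 2) * ∑ j, v j ^ 2 := by
    intro i
    have e : (Matrix.toEuclideanCLM (𝕜 := ℝ) M) v i = ∑ j, M i j * v j := by
      rw [Matrix.ofLp_toEuclideanCLM]; rfl
    rw [e]
    refine (Finset.sum_mul_sq_le_sq_mul_sq _ _ _).trans ?_
    refine mul_le_mul_of_nonneg_right ?_ (Finset.sum_nonneg fun _ _ => sq_nonneg _)
    calc ∑ j, M i j ^ 2 ≤ ∑ j : Fin n, m ^ 2 :=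
          Finset.sum_le_sum fun j _ => sq_le_sq' (abs_le.1 (h i j)).1 (abs_le.1 (h i j)).2
      _ = _ := by simp
  calc _ ≤ ∑ i : Fin n, (n * m ^ 2) * ∑ j, v j ^ 2 := Finset.sum_le_sum fun i _ => key i
    _ = _ := by simp; ring

/-- the Gram matrix of the degree-`q` polynomial lifting for the
Gaussian kernel approximates the Gaussian kernel matrix to within `n^{-c}` in
operator norm, once `q ≥ C (r + log n)`. The lifting coordinates are indexed by
`Σ j : Fin (q+1), (Fin j → Fin d)`, i.e. by tuples indexing the entries of the
tensor powers `x^{⊗j}`, `j = 0, …, q`. -/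
theorem gaussian_polynomial_lifting_operator_norm_close :
    ∀ c : ℝ, 0 < c →
      ∃ C : ℝ, 0 < C ∧
        ∀ (d n q : ℕ) (r : ℝ) (x : Fin n → Fin d → ℝ),
          (∀ i, ∑ k, (x i k) ^ 2 ≤ r) →
          (C * (r + Real.log n) ≤ (q : ℝ)) →
          ∀ (K : Matrix (Fin n) (Fin n) ℝ)
            (A : Matrix ((j : Fin (q + 1)) × (Fin (j : ℕ) → Fin d)) (Fin n) ℝ),
            (∀ i j, K i j = Real.exp (-(∑ k, (x i k - x j k) ^ 2) / 2)) →
            (∀ (j : Fin (q + 1)) (t : Fin (j : ℕ) → Fin d) (i : Fin n),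
              A ⟨j, t⟩ i =
                Real.exp (-(∑ k, (x i k) ^ 2) / 2) *
                  (∏ a, x i (t a)) / Real.sqrt (Nat.factorial (j : ℕ))) →
            ‖Matrix.toEuclideanCLM (𝕜 := ℝ) (Aᵀ * A - K)‖ ≤ (n : ℝ) ^ (-c) := by
  intro c hc
  refine ⟨c + 3, by linarith, ?_⟩
  intro d n q r x hx hq K A hK hA
  rcases Nat.eq_zero_or_pos n with rfl | hn
  · have : Aᵀ * A - K = 0 := by ext i; exact i.elim0
    rw [this]
    simp only [map_zero, norm_zero]
    positivity
  have hn' : (0 : ℝ) < n := by exact_mod_cast hn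
  have hlog : 0 ≤ Real.log n := Real.log_nonneg (by exact_mod_cast hn)
  have hr : 0 ≤ r := (Finset.sum_nonneg fun _ _ => sq_nonneg _).trans (hx ⟨0, hn⟩)
  have hfin : (n : ℝ) ^ (-c) = n * (n : ℝ) ^ (-c - 1) := by
    rw [Real.rpow_sub_one hn'.ne']; field_simp
  rw [hfin]
  apply opNorm_le_of_entries _ _ _ (by positivity)
  intro i j
  set y := ∑ k, x i k * x j k with hy
  set s := (∑ k, x i k ^ 2 + ∑ k, x j k ^ 2) / 2 with hs
  have hys : |y| ≤ s := by
    rw [hy, hs, ← Finset.sum_add_distrib, Finset.sum_div]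
    refine (Finset.abs_sum_le_sum_abs _ _).trans (Finset.sum_le_sum fun k _ => ?_)
    rw [abs_le]
    constructor <;> nlinarith [sq_nonneg (x i k + x j k), sq_nonneg (x i k - x j k)]
  have hsr : s ≤ r := by have := hx i; have := hx j; linarith
  have hs0 : 0 ≤ s := (abs_nonneg y).trans hys
  have hKe : K i j = Real.exp (-s) * Real.exp y := by
    rw [hK, ← Real.exp_add]
    congr 1
    have : ∑ k, (x i k - x j k) ^ 2 = ∑ k, x i k ^ 2 + ∑ k, x j k ^ 2 - 2 * y := by
      rw [hy, Finset.mul_sum, ← Finset.sum_add_distrib, ← Finset.sum_sub_distrib]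
      exact Finset.sum_congr rfl fun k _ => by ring
    rw [this, hs]; ring
  have hG : (Aᵀ * A) i j
      = Real.exp (-s) * ∑ k ∈ Finset.range (q + 1), y ^ k / (k.factorial : ℝ) := by
    rw [Matrix.mul_apply, Fintype.sum_sigma, Finset.sum_range, Finset.mul_sum]
    refine Finset.sum_congr rfl fun k _ => ?_
    have hp : y ^ (k : ℕ) = ∑ t : Fin (k : ℕ) → Fin d, ∏ a, (x i (t a) * x j (t a)) := by
      rw [hy, Fintype.sum_pow]
    rw [hp, Finset.sum_div, Finset.mul_sum]
    refine Finset.sum_congr rfl fun t _ => ?_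
    rw [Matrix.transpose_apply, hA, hA, Finset.prod_mul_distrib]
    have he : Real.exp (-s) = Real.exp (-(∑ k, (x i k) ^ 2) / 2)
        * Real.exp (-(∑ k, (x j k) ^ 2) / 2) := by
      rw [← Real.exp_add, hs]; congr 1; ring
    have hf : Real.sqrt ((k : ℕ).factorial : ℝ) * Real.sqrt ((k : ℕ).factorial : ℝ)
        = ((k : ℕ).factorial : ℝ) := Real.mul_self_sqrt (by positivity)
    rw [he, div_mul_div_comm, hf]
    ring
  rw [Matrix.sub_apply, hG, hKe, ← mul_sub, abs_mul, abs_of_pos (Real.exp_pos _)]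
  calc _ ≤ Real.exp (-s) * (Real.exp (-(q : ℝ)) * Real.exp (Real.exp 1 * s)) := by
        gcongr
        exact exp_tail_bound y s hys q
    _ = Real.exp (-s + (-(q : ℝ) + Real.exp 1 * s)) := by rw [Real.exp_add, Real.exp_add]
    _ ≤ Real.exp (Real.log n * (-c - 1)) := by
        apply Real.exp_le_exp.2
        have he : Real.exp 1 ≤ 3 := by linarith [Real.exp_one_lt_d9]
        have h1 : Real.exp 1 * s ≤ 3 * s := by gcongr
        nlinarith [mul_nonneg hc.le hr]
    _ = (n : ℝ) ^ (-c - 1) := by rw [Real.rpow_def_of_pos hn']
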